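/- Suppose R_n R_{n+1} sin(φ_{n+1} − φ_n) = 1 for all n ≥ 1 with R_n > 0 and φ_{n+1} − φ_n ∈ (0, π), and define b_{n+1} = R_n R_{n+2} sin(φ_{n+2} − φ_n). Setting c_n = R_n cos φ_n and s_n = R_n sin φ_n, the sequences c and s satisfy the discrete Schrödinger zero-energy equation −y_{n+1} − y_{n-1} + b_n y_n = 0 for all n ≥ 2. -/

import Mathlib

open Real

/-- The polar data of a discrete Schrödinger canonical system gives zero-energy
solutions of the discrete Schrödinger equation `-y_{n+1} - y_{n-1} + b_n y_n = 0`. -/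
theorem discrete_schrodinger_zero_energy (R φ b c s : ℕ → ℝ)
    (hR : ∀ n, 1 ≤ n → R n > 0)
    (hW : ∀ n, 1 ≤ n → R n * R (n + 1) * Real.sin (φ (n + 1) - φ n) = 1)
    (hφ : ∀ n, 1 ≤ n → φ (n + 1) - φ n ∈ Set.Ioo 0 Real.pi)
    (hb : ∀ n, 1 ≤ n → b (n + 1) = R n * R (n + 2) * Real.sin (φ (n + 2) - φ n))
    (hc : ∀ n, 1 ≤ n → c n = R n * Real.cos (φ n))
    (hs : ∀ n, 1 ≤ n → s n = R n * Real.sin (φ n)) :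
    ∀ n, 1 ≤ n →
      (-(c (n + 2)) - c n + b (n + 1) * c (n + 1) = 0 ∧
       -(s (n + 2)) - s n + b (n + 1) * s (n + 1) = 0) := by
  intro n hn
  have h1 := hW n hn
  have h2 := hW (n + 1) (by omega)
  have h3 := hb n hn
  simp only [add_assoc, Nat.reduceAdd] at h2
  rw [Real.sin_sub] at h1 h2 h3
  rw [hc n hn, hc (n + 1) (by omega), hc (n + 2) (by omega),
    hs n hn, hs (n + 1) (by omega), hs (n + 2) (by omega), h3]
  constructor
  · linear_combination (R (n + 2) * Real.cos (φ (n + 2))) * h1 + (R n * Real.cos (φ n)) * h2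
  · linear_combination (R (n + 2) * Real.sin (φ (n + 2))) * h1 + (R n * Real.sin (φ n)) * h2
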